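/- (Semi-quasi-correlations) Let ℓ ≥ 2 be an integer and δ > 0, and write ξ = (ξ¹, ξ²) ∈ ℤ². Then there exists a density one subsequence S'⊆S such that for every sufficiently large λ ∈ S', each i ∈ {1,2}, and all ξ₁, …, ξ_{2ℓ} ∈ ℤ² with |ξ_j|² = λ and ξ^i₁ + ⋯ + ξ^i_{2ℓ} ≠ 0, one has |ξ^i₁ + ξ^i₂ + ⋯ + ξ^i_{2ℓ}| ≥ λ^{1/2 − δ}. -/

import Mathlib

open Filter Topology

noncomputable section

/-- `S`: the set of positive integers expressible as a sum of two squares. -/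
def sumTwoSq : Set ℕ := {n | 0 < n ∧ ∃ a b : ℤ, (n : ℤ) = a ^ 2 + b ^ 2}

/-- `S' ⊆ S` is a density one subsequence of `S`. -/
def DensityOne (S' : Set ℕ) : Prop :=
  S' ⊆ sumTwoSq ∧
    Tendsto
      (fun X : ℕ =>
        (Nat.card {n : ℕ | n ∈ S' ∧ n ≤ X} : ℝ) /
          (Nat.card {n : ℕ | n ∈ sumTwoSq ∧ n ≤ X} : ℝ))
      atTop (𝓝 1)

/-! ### Gaussian integers of given norm -/

theorem gaussianInt_norm_eq (z : GaussianInt) : z.norm = z.re ^ 2 + z.im ^ 2 := by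
  rw [Zsqrtd.norm_def]; ring

theorem gaussianInt_norm_star (z : GaussianInt) : (star z).norm = z.norm := by
  simp [gaussianInt_norm_eq]

theorem gaussianInt_prime_of_norm_prime {p : ℕ} (hp : p.Prime) {π : GaussianInt}
    (hπ : π.norm = p) : Prime π := by
  rw [← irreducible_iff_prime]
  refine ⟨fun h => ?_, fun a b hab => ?_⟩
  · rw [← Zsqrtd.norm_eq_one_iff, hπ, Int.natAbs_natCast] at h
    exact hp.one_lt.ne' h
  · have h : a.norm.natAbs * b.norm.natAbs = p := by
      rw [← Int.natAbs_mul, ← Zsqrtd.norm_mul, ← hab, hπ, Int.natAbs_natCast]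
    rw [← Zsqrtd.norm_eq_one_iff, ← Zsqrtd.norm_eq_one_iff]
    have := (Nat.prime_mul_iff.1 (h ▸ hp))
    tauto

theorem gaussianInt_dvd_or_star_dvd {p : ℕ} (hp : p.Prime) {π z : GaussianInt}
    (hπ : π.norm = p) (hz : (p : ℤ) ∣ z.norm) : π ∣ z ∨ star π ∣ z := by
  have h1 : π ∣ z * star z := by
    rw [← Zsqrtd.norm_eq_mul_conj]
    refine dvd_trans ⟨star π, ?_⟩ ((Zsqrtd.intCast_dvd_intCast _ _).2 hz)
    rw [← Zsqrtd.norm_eq_mul_conj, hπ]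
  refine ((gaussianInt_prime_of_norm_prime hp hπ).dvd_or_dvd h1).imp_right ?_
  rintro ⟨c, hc⟩
  exact ⟨star c, by rw [← star_star z, hc, star_mul, mul_comm]⟩

theorem gaussianInt_natCast_dvd {p : ℕ} (hp : Irreducible (p : GaussianInt)) {z : GaussianInt}
    (hz : (p : ℤ) ∣ z.norm) : (p : GaussianInt) ∣ z := by
  have h1 : (p : GaussianInt) ∣ z * star z := by
    rw [← Zsqrtd.norm_eq_mul_conj]
    simpa using (Zsqrtd.intCast_dvd_intCast (d := -1) _ _).2 hz
  refine ((irreducible_iff_prime.1 hp).dvd_or_dvd h1).elim id ?_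
  rintro ⟨c, hc⟩
  exact ⟨star c, by rw [← star_star z, hc, star_mul, star_natCast, mul_comm]⟩

theorem exists_norm_eq_of_not_irreducible {p : ℕ} (hp : p.Prime)
    (h : ¬ Irreducible (p : GaussianInt)) : ∃ π : GaussianInt, π.norm = p := by
  have := Fact.mk hp
  obtain ⟨a, b, hab⟩ := GaussianInt.sq_add_sq_of_nat_prime_of_not_irreducible p h
  exact ⟨⟨a, b⟩, by rw [gaussianInt_norm_eq]; dsimp only; exact_mod_cast hab⟩

/-- If a prime `p` divides `n` exactly once, real parts of Gaussian integers of norm `n` are all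
of the form `Re (π w)`, with `π` a fixed element of norm `p`. -/
theorem exists_re_eq_re_mul {p m : ℕ} (hp : p.Prime) (hpm : ¬ p ∣ m)
    {z₀ : GaussianInt} (hz₀ : z₀.norm = (p * m : ℕ)) :
    ∃ π : GaussianInt, π.norm = p ∧ ∀ z : GaussianInt, z.norm = (p * m : ℕ) →
      ∃ w : GaussianInt, w.norm = m ∧ z.re = (π * w).re := by
  have hp0 : (p : ℤ) ≠ 0 := by exact_mod_cast hp.ne_zero
  by_cases hirr : Irreducible (p : GaussianInt)
  · exfalso
    obtain ⟨c, hc⟩ := gaussianInt_natCast_dvd (z := z₀) hirr ⟨m, by rw [hz₀]; push_cast; ring⟩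
    rw [hc, Zsqrtd.norm_mul, Zsqrtd.norm_natCast] at hz₀
    push_cast at hz₀
    rw [mul_assoc] at hz₀
    have := mul_left_cancel₀ hp0 hz₀
    exact hpm (Int.natCast_dvd_natCast.1 ⟨_, this.symm⟩)
  · obtain ⟨π, hπ⟩ := exists_norm_eq_of_not_irreducible hp hirr
    refine ⟨π, hπ, fun z hz => ?_⟩
    rcases gaussianInt_dvd_or_star_dvd hp hπ (z := z) ⟨m, by rw [hz]; push_cast; ring⟩ with ⟨c, hc⟩ | ⟨c, hc⟩
    · refine ⟨c, ?_, by rw [hc]⟩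
      rw [hc, Zsqrtd.norm_mul, hπ] at hz
      push_cast at hz
      exact mul_left_cancel₀ hp0 hz
    · refine ⟨star c, ?_, ?_⟩
      · rw [gaussianInt_norm_star]
        rw [hc, Zsqrtd.norm_mul, gaussianInt_norm_star, hπ] at hz
        push_cast at hz
        exact mul_left_cancel₀ hp0 hz
      · rw [hc]; simp [Zsqrtd.re_mul]

/-- The Gaussian integers of norm `n`. -/
def latticeCircle (n : ℕ) : Finset GaussianInt :=
  ((Finset.Icc (-n : ℤ) n ×ˢ Finset.Icc (-n : ℤ) n).filter
    fun q : ℤ × ℤ => q.1 ^ 2 + q.2 ^ 2 = n).image fun q => ⟨q.1, q.2⟩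

theorem mem_latticeCircle {n : ℕ} {z : GaussianInt} : z ∈ latticeCircle n ↔ z.norm = n := by
  rw [gaussianInt_norm_eq]
  simp only [latticeCircle, Finset.mem_image, Finset.mem_filter, Finset.mem_product,
    Finset.mem_Icc, Prod.exists]
  constructor
  · rintro ⟨a, b, ⟨-, h⟩, rfl⟩
    exact h
  · intro h
    refine ⟨z.re, z.im, ⟨⟨⟨?_, ?_⟩, ?_, ?_⟩, h⟩, rfl⟩ <;> nlinarith

theorem exists_family_norm_prime_pow_mul {p a : ℕ} (hp : p.Prime) (hpa : ¬ p ∣ a) (k : ℕ) :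
    ∃ β : ℕ → GaussianInt, ∀ z : GaussianInt, z.norm = (p ^ k * a : ℕ) →
      ∃ j ≤ k, ∃ w : GaussianInt, w.norm = a ∧ z = β j * w := by
  have hp0 : (p : ℤ) ≠ 0 := by exact_mod_cast hp.ne_zero
  by_cases hirr : Irreducible (p : GaussianInt)
  · refine ⟨fun j => (p : GaussianInt) ^ (k / 2), ?_⟩
    induction k using Nat.strong_induction_on with
    | _ k ih =>
      intro z hz
      rcases Nat.eq_zero_or_pos k with rfl | hk
      · exact ⟨0, le_rfl, z, by simpa using hz, by simp⟩
      obtain ⟨c, hc⟩ := gaussianInt_natCast_dvd (z := z) hirr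
        (by rw [hz]; exact_mod_cast (dvd_pow_self p hk.ne').mul_right a)
      rw [hc, Zsqrtd.norm_mul, Zsqrtd.norm_natCast] at hz
      push_cast at hz
      obtain ⟨k, rfl⟩ : ∃ k', k = k' + 1 := ⟨k - 1, by omega⟩
      have hz1 : (p : ℤ) * c.norm = p ^ k * a := by
        apply mul_left_cancel₀ hp0
        rw [← mul_assoc, hz]; ring
      rcases Nat.eq_zero_or_pos k with rfl | hk'
      · exact absurd (Int.natCast_dvd_natCast.1 ⟨c.norm, by simpa using hz1.symm⟩) hpa
      obtain ⟨k, rfl⟩ : ∃ k', k = k' + 1 := ⟨k - 1, by omega⟩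
      have hz2 : c.norm = p ^ k * a := by
        apply mul_left_cancel₀ hp0
        rw [hz1]; ring
      obtain ⟨j, hj, w, hw, hcw⟩ := ih k (by omega) c (by exact_mod_cast hz2)
      refine ⟨j, by omega, w, hw, ?_⟩
      rw [hc, hcw, show (k + 1 + 1) / 2 = k / 2 + 1 by omega]
      ring
  · obtain ⟨π, hπ⟩ := exists_norm_eq_of_not_irreducible hp hirr
    refine ⟨fun j => π ^ j * star π ^ (k - j), ?_⟩
    induction k with
    | zero => exact fun z hz => ⟨0, le_rfl, z, by simpa using hz, by simp⟩
    | succ k ih =>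
      intro z hz
      rcases gaussianInt_dvd_or_star_dvd hp hπ (z := z)
        (by rw [hz]; exact_mod_cast (dvd_pow_self p k.succ_ne_zero).mul_right a) with ⟨c, hc⟩ | ⟨c, hc⟩
      · obtain ⟨j, hj, w, hw, hcw⟩ := ih c (by
          apply mul_left_cancel₀ hp0
          rw [hc, Zsqrtd.norm_mul, hπ] at hz
          rw [hz]; push_cast; ring)
        refine ⟨j + 1, by omega, w, hw, ?_⟩
        simp only [hc, hcw, show k + 1 - (j + 1) = k - j by omega]
        ring
      · obtain ⟨j, hj, w, hw, hcw⟩ := ih c (by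
          apply mul_left_cancel₀ hp0
          rw [hc, Zsqrtd.norm_mul, gaussianInt_norm_star, hπ] at hz
          rw [hz]; push_cast; ring)
        refine ⟨j, by omega, w, hw, ?_⟩
        simp only [hc, hcw, show k + 1 - j = k - j + 1 by omega]
        ring

theorem card_latticeCircle_le (n : ℕ) (hn : n ≠ 0) :
    (latticeCircle n).card ≤ 4 * n.divisors.card := by
  induction n using Nat.recOnPrimePow with
  | zero => exact absurd rfl hn
  | one => decide
  | prime_pow_mul a p k hp hpa hk ih =>
    obtain ⟨β, hβ⟩ := exists_family_norm_prime_pow_mul hp hpa k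
    have hsub : latticeCircle (p ^ k * a) ⊆
        (Finset.range (k + 1)).biUnion fun j => (latticeCircle a).image fun w => β j * w := by
      intro z hz
      obtain ⟨j, hj, w, hw, rfl⟩ := hβ z (mem_latticeCircle.1 hz)
      simp only [Finset.mem_biUnion, Finset.mem_range, Finset.mem_image]
      exact ⟨j, by omega, w, mem_latticeCircle.2 hw, rfl⟩
    have hcop : Nat.Coprime (p ^ k) a := (Nat.Prime.coprime_iff_not_dvd hp).2 hpa |>.pow_left k
    have hdiv : (p ^ k * a).divisors.card = (k + 1) * a.divisors.card := by
      rw [hcop.card_divisors_mul, Nat.divisors_prime_pow hp, Finset.card_map, Finset.card_range]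
    calc (latticeCircle (p ^ k * a)).card
        ≤ (k + 1) * (latticeCircle a).card := by
          refine (Finset.card_le_card hsub).trans ?_
          refine (Finset.card_biUnion_le_card_mul _ _ _ fun j _ => Finset.card_image_le).trans ?_
          simp
      _ ≤ (k + 1) * (4 * a.divisors.card) := by
          gcongr
          exact ih (by rintro rfl; simp at hn)
      _ = 4 * (p ^ k * a).divisors.card := by rw [hdiv]; ring

/-! ### Logarithmic averages -/

theorem sum_Icc_inv_le (X : ℕ) : ∑ n ∈ Finset.Icc 1 X, (1 : ℝ) / n ≤ 1 + Real.log X := by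
  have h := harmonic_le_one_add_log X
  rw [harmonic_eq_sum_Icc] at h
  push_cast at h
  simpa [one_div] using h

theorem card_divisors_mul_le (a b : ℕ) :
    (a * b).divisors.card ≤ a.divisors.card * b.divisors.card := by
  rw [Nat.divisors_mul]
  exact Finset.card_mul_le

theorem sum_card_divisors_pow_div_le (X k : ℕ) :
    ∑ n ∈ Finset.Icc 1 X, (n.divisors.card : ℝ) ^ k / n ≤ (1 + Real.log X) ^ 2 ^ k := by
  induction k with
  | zero => simpa using sum_Icc_inv_le X
  | succ k ih =>
    have hnn : 0 ≤ ∑ n ∈ Finset.Icc 1 X, (n.divisors.card : ℝ) ^ k / n :=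
      Finset.sum_nonneg fun n _ => by positivity
    calc ∑ n ∈ Finset.Icc 1 X, (n.divisors.card : ℝ) ^ (k + 1) / n
        = ∑ n ∈ Finset.Icc 1 X, ∑ q ∈ n.divisorsAntidiagonal,
            ((q.1 * q.2).divisors.card : ℝ) ^ k / (q.1 * q.2 : ℕ) := by
          refine Finset.sum_congr rfl fun n _ => ?_
          rw [Finset.sum_congr rfl (g := fun _ => (n.divisors.card : ℝ) ^ k / n), Finset.sum_const,
            nsmul_eq_mul, ← Nat.map_div_right_divisors, Finset.card_map]
          · ring
          · intro q hq
            rw [(Nat.mem_divisorsAntidiagonal.1 hq).1]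
      _ = ∑ s ∈ (Finset.Icc 1 X).sigma fun n => n.divisorsAntidiagonal,
            ((s.2.1 * s.2.2).divisors.card : ℝ) ^ k / (s.2.1 * s.2.2 : ℕ) :=
          (Finset.sum_sigma (Finset.Icc 1 X) (fun n => n.divisorsAntidiagonal) (fun s =>
            ((s.2.1 * s.2.2).divisors.card : ℝ) ^ k / (s.2.1 * s.2.2 : ℕ))).symm
      _ ≤ ∑ q ∈ Finset.Icc 1 X ×ˢ Finset.Icc 1 X,
            ((q.1 * q.2).divisors.card : ℝ) ^ k / (q.1 * q.2 : ℕ) := by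
          rw [← Finset.sum_image (f := fun q : ℕ × ℕ =>
            ((q.1 * q.2).divisors.card : ℝ) ^ k / (q.1 * q.2 : ℕ))
            (g := fun s : (Σ _ : ℕ, ℕ × ℕ) => s.2)]
          · refine Finset.sum_le_sum_of_subset_of_nonneg ?_ fun q _ _ => by positivity
            intro q hq
            simp only [Finset.mem_image, Finset.mem_sigma, Finset.mem_Icc,
              Nat.mem_divisorsAntidiagonal] at hq
            obtain ⟨⟨n, q'⟩, ⟨hn, hq', hn0⟩, rfl⟩ := hq
            simp only [Finset.mem_product, Finset.mem_Icc]
            simp only at hq' hn hn0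
            have h1 : q'.1 ≠ 0 := by rintro h; simp [h] at hq'; omega
            have h2 : q'.2 ≠ 0 := by rintro h; simp [h] at hq'; omega
            have h3 : q'.1 ≤ n := Nat.le_of_dvd hn.1 ⟨_, hq'.symm⟩
            have h4 : q'.2 ≤ n := Nat.le_of_dvd hn.1 ⟨_, by rw [← hq', mul_comm]⟩
            omega
          · rintro ⟨n, q⟩ hn ⟨n', q'⟩ hn' h
            simp only [Finset.coe_sigma, Set.mem_sigma_iff, Finset.mem_coe,
              Nat.mem_divisorsAntidiagonal] at hn hn' h
            subst h
            obtain rfl : n = n' := by rw [← hn.2.1, ← hn'.2.1]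
            rfl
      _ ≤ ∑ q ∈ Finset.Icc 1 X ×ˢ Finset.Icc 1 X,
            ((q.1.divisors.card : ℝ) ^ k / q.1) * ((q.2.divisors.card : ℝ) ^ k / q.2) := by
          refine Finset.sum_le_sum fun q _ => ?_
          rw [div_mul_div_comm, ← mul_pow]
          push_cast
          gcongr
          exact_mod_cast card_divisors_mul_le _ _
      _ = (∑ n ∈ Finset.Icc 1 X, (n.divisors.card : ℝ) ^ k / n) ^ 2 := by
          rw [Finset.sum_product, sq, Finset.sum_mul_sum]
      _ ≤ ((1 + Real.log X) ^ 2 ^ k) ^ 2 := by gcongr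
      _ = (1 + Real.log X) ^ 2 ^ (k + 1) := by rw [← pow_mul, pow_succ]

theorem sum_Icc_le_mul_sum_div (X : ℕ) (f : ℕ → ℝ) (hf : ∀ n, 0 ≤ f n) :
    ∑ n ∈ Finset.Icc 1 X, f n ≤ X * ∑ n ∈ Finset.Icc 1 X, f n / n := by
  rw [Finset.mul_sum]
  refine Finset.sum_le_sum fun n hn => ?_
  rw [Finset.mem_Icc] at hn
  have h0 : (0 : ℝ) < n := by exact_mod_cast hn.1
  have h1 : (n : ℝ) ≤ X := by exact_mod_cast hn.2
  rw [mul_div_assoc', le_div_iff₀ h0, mul_comm]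
  exact mul_le_mul_of_nonneg_right h1 (hf n)

theorem card_many_divisors_le (X : ℕ) {D : ℝ} (hD : 0 < D) :
    (((Finset.Icc 1 X).filter fun n => D < n.divisors.card).card : ℝ) ≤
      X * (1 + Real.log X) ^ 2 / D := by
  rw [le_div_iff₀ hD, ← nsmul_eq_mul]
  calc ((Finset.Icc 1 X).filter fun n => D < n.divisors.card).card • D
      ≤ ∑ n ∈ (Finset.Icc 1 X).filter fun n => D < n.divisors.card, (n.divisors.card : ℝ) :=
        Finset.card_nsmul_le_sum _ _ _ fun n hn => (Finset.mem_filter.1 hn).2.le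
    _ ≤ ∑ n ∈ Finset.Icc 1 X, (n.divisors.card : ℝ) :=
        Finset.sum_le_sum_of_subset_of_nonneg (Finset.filter_subset _ _) fun _ _ _ => by positivity
    _ ≤ X * ∑ n ∈ Finset.Icc 1 X, (n.divisors.card : ℝ) / n :=
        sum_Icc_le_mul_sum_div X _ fun _ => by positivity
    _ ≤ X * (1 + Real.log X) ^ 2 := by
        gcongr
        simpa using sum_card_divisors_pow_div_le X 1

open scoped Classical in
theorem card_large_square_divisor_le (X : ℕ) {y : ℝ} (hy : 0 < y) :
    (((Finset.Icc 1 X).filter fun n => ∃ v : ℕ, y < v ∧ v ^ 2 ∣ n).card : ℝ) ≤ 2 * X / y := by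
  have hsub : ((Finset.Icc 1 X).filter fun n => ∃ v : ℕ, y < v ∧ v ^ 2 ∣ n) ⊆
      (Finset.Ioo ⌊y⌋₊ (X + 1)).biUnion fun v => (Finset.Ioc 0 X).filter fun n => v ^ 2 ∣ n := by
    intro n hn
    simp only [Finset.mem_filter, Finset.mem_Icc] at hn
    obtain ⟨⟨hn1, hnX⟩, v, hv, hvn⟩ := hn
    have : v ≤ v ^ 2 := Nat.le_self_pow two_ne_zero v
    have : v ^ 2 ≤ n := Nat.le_of_dvd hn1 hvn
    simp only [Finset.mem_biUnion, Finset.mem_filter, Finset.mem_Ioo, Finset.mem_Ioc]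
    exact ⟨v, ⟨(Nat.floor_lt hy.le).2 hv, by omega⟩, by omega, hvn⟩
  calc (((Finset.Icc 1 X).filter fun n => ∃ v : ℕ, y < v ∧ v ^ 2 ∣ n).card : ℝ)
      ≤ ∑ v ∈ Finset.Ioo ⌊y⌋₊ (X + 1), (((Finset.Ioc 0 X).filter fun n => v ^ 2 ∣ n).card : ℝ) := by
        exact_mod_cast (Finset.card_le_card hsub).trans Finset.card_biUnion_le
    _ ≤ ∑ v ∈ Finset.Ioo ⌊y⌋₊ (X + 1), (X : ℝ) * ((v : ℝ) ^ 2)⁻¹ := by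
        refine Finset.sum_le_sum fun v _ => ?_
        rw [Nat.Ioc_filter_dvd_card_eq_div, ← div_eq_mul_inv]
        exact_mod_cast Nat.cast_div_le
    _ = X * ∑ v ∈ Finset.Ioo ⌊y⌋₊ (X + 1), ((v : ℝ) ^ 2)⁻¹ := by rw [Finset.mul_sum]
    _ ≤ X * (2 / (⌊y⌋₊ + 1)) := by
        gcongr
        exact sum_Ioo_inv_sq_le _ _
    _ ≤ X * (2 / y) := by
        gcongr
        exact (Nat.lt_floor_add_one y).le
    _ = 2 * X / y := by ring

/-! ### Lower bound for the number of sums of two squares -/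

theorem mem_sumTwoSq_iff {n : ℕ} : n ∈ sumTwoSq ↔ 0 < n ∧ (latticeCircle n).Nonempty := by
  refine and_congr_right fun _ => ⟨?_, ?_⟩
  · rintro ⟨a, b, h⟩
    exact ⟨⟨a, b⟩, mem_latticeCircle.2 (by rw [gaussianInt_norm_eq, h])⟩
  · rintro ⟨z, hz⟩
    exact ⟨z.re, z.im, by rw [← gaussianInt_norm_eq, mem_latticeCircle.1 hz]⟩

theorem le_sum_card_latticeCircle (X : ℕ) :
    X ≤ 8 * ∑ n ∈ Finset.Icc 1 X, (latticeCircle n).card := by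
  rcases Nat.lt_or_ge X 2 with hX | hX
  · interval_cases X
    · simp
    · decide
  set s := Nat.sqrt (X / 2) with hs
  have hs1 : s * s ≤ X / 2 := Nat.sqrt_le _
  have hs2 : X / 2 < (s + 1) * (s + 1) := Nat.lt_succ_sqrt _
  have hs0 : 1 ≤ s := by
    rw [hs, Nat.le_sqrt]; omega
  have hcard : s * s ≤ ∑ n ∈ Finset.Icc 1 X, (latticeCircle n).card := by
    rw [← Finset.card_sigma]
    calc s * s = (Finset.Icc 1 s ×ˢ Finset.Icc 1 s).card := by simp
      _ ≤ _ := by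
        refine Finset.card_le_card_of_injOn
          (fun q => ⟨q.1 ^ 2 + q.2 ^ 2, ⟨(q.1 : ℤ), (q.2 : ℤ)⟩⟩) ?_ ?_
        · intro q hq
          simp only [Finset.coe_product, Finset.coe_Icc, Set.mem_prod, Set.mem_Icc] at hq
          simp only [Finset.coe_sigma, Set.mem_sigma_iff, Finset.coe_Icc, Set.mem_Icc,
            Finset.mem_coe, mem_latticeCircle, gaussianInt_norm_eq]
          refine ⟨⟨by nlinarith [hq.1.1], ?_⟩, by push_cast; rfl⟩
          have := Nat.mul_le_mul hq.1.2 hq.1.2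
          have := Nat.mul_le_mul hq.2.2 hq.2.2
          rw [sq, sq]
          omega
        · intro q _ q' _ h
          simp only [Sigma.mk.injEq] at h
          obtain ⟨h1, h2⟩ := h
          have h3 := eq_of_heq h2
          simp only [Zsqrtd.ext_iff, Nat.cast_inj] at h3
          ext
          · exact h3.1
          · exact h3.2
  have h1 : (s + 1) * (s + 1) ≤ 4 * (s * s) := by nlinarith
  omega

theorem le_card_sumTwoSq (X : ℕ) (hX : 0 < X) :
    (X : ℝ) ≤ 1024 * (1 + Real.log X) ^ 4 * Nat.card {n : ℕ | n ∈ sumTwoSq ∧ n ≤ X} := by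
  classical
  set T := (Finset.Icc 1 X).filter fun n => (latticeCircle n).Nonempty
  have hT : Nat.card {n : ℕ | n ∈ sumTwoSq ∧ n ≤ X} = T.card := by
    rw [← Set.ncard_coe_finset, Nat.card_coe_set_eq]
    congr 1
    ext n
    simp [T, mem_sumTwoSq_iff, Nat.succ_le_iff]
    tauto
  have hX' : (0 : ℝ) < X := by exact_mod_cast hX
  rw [hT]
  have h1 : ∑ n ∈ T, (latticeCircle n).card = ∑ n ∈ Finset.Icc 1 X, (latticeCircle n).card := by
    refine Finset.sum_filter_of_ne fun n _ h => ?_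
    exact Finset.card_pos.1 (Nat.pos_of_ne_zero h)
  have h2 : (X : ℝ) ≤ 8 * ∑ n ∈ T, ((latticeCircle n).card : ℝ) := by
    have := le_sum_card_latticeCircle X
    rw [← h1] at this
    exact_mod_cast this
  have h3 : ∑ n ∈ T, ((latticeCircle n).card : ℝ) ^ 2 ≤ 16 * (X * (1 + Real.log X) ^ 4) := by
    calc ∑ n ∈ T, ((latticeCircle n).card : ℝ) ^ 2
        ≤ ∑ n ∈ T, 16 * (n.divisors.card : ℝ) ^ 2 := by
          refine Finset.sum_le_sum fun n hn => ?_
          have hn0 : n ≠ 0 := by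
            have := (Finset.mem_Icc.1 (Finset.mem_filter.1 hn).1).1
            omega
          have : ((latticeCircle n).card : ℝ) ≤ 4 * n.divisors.card := by
            exact_mod_cast card_latticeCircle_le n hn0
          calc ((latticeCircle n).card : ℝ) ^ 2 ≤ (4 * n.divisors.card) ^ 2 := by gcongr
            _ = _ := by ring
      _ ≤ ∑ n ∈ Finset.Icc 1 X, 16 * (n.divisors.card : ℝ) ^ 2 :=
          Finset.sum_le_sum_of_subset_of_nonneg (Finset.filter_subset _ _)
            fun _ _ _ => by positivity
      _ = 16 * ∑ n ∈ Finset.Icc 1 X, (n.divisors.card : ℝ) ^ 2 := by rw [Finset.mul_sum]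
      _ ≤ 16 * (X * (1 + Real.log X) ^ 4) := by
          gcongr
          refine (sum_Icc_le_mul_sum_div X _ fun _ => by positivity).trans ?_
          gcongr
          exact sum_card_divisors_pow_div_le X 2
  have h4 := sq_sum_le_card_mul_sum_sq (s := T) (f := fun n => ((latticeCircle n).card : ℝ))
  have h5 : (X : ℝ) ^ 2 ≤ 64 * (T.card * (16 * (X * (1 + Real.log X) ^ 4))) := by
    calc (X : ℝ) ^ 2 ≤ (8 * ∑ n ∈ T, ((latticeCircle n).card : ℝ)) ^ 2 := by gcongr
      _ = 64 * (∑ n ∈ T, ((latticeCircle n).card : ℝ)) ^ 2 := by ring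
      _ ≤ _ := by
        gcongr
        exact h4.trans (by gcongr)
  refine le_of_mul_le_mul_left ?_ hX'
  nlinarith

/-! ### Gaussian integers near a line -/

theorem card_le_of_abs_sub_le (T : Finset ℤ) {x r : ℝ} (hr : 0 ≤ r)
    (hT : ∀ a ∈ T, |(a : ℝ) - x| ≤ r) : (T.card : ℝ) ≤ 2 * r + 1 := by
  have hsub : T ⊆ Finset.Icc ⌈x - r⌉ ⌊x + r⌋ := by
    intro a ha
    have h := abs_le.1 (hT a ha)
    rw [Finset.mem_Icc, Int.ceil_le, Int.le_floor]
    constructor <;> linarith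
  have h1 : (T.card : ℝ) ≤ ((⌊x + r⌋ + 1 - ⌈x - r⌉).toNat : ℝ) := by
    rw [← Int.card_Icc]
    exact_mod_cast Finset.card_le_card hsub
  have h2 := Int.floor_le (x + r)
  have h3 := Int.le_ceil (x - r)
  refine h1.trans ?_
  rcases le_total 0 (⌊x + r⌋ + 1 - ⌈x - r⌉) with h | h
  · have h4 : (((⌊x + r⌋ + 1 - ⌈x - r⌉).toNat : ℤ) : ℝ) = ((⌊x + r⌋ + 1 - ⌈x - r⌉ : ℤ) : ℝ) := by
      rw [Int.toNat_of_nonneg h]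
    rw [Int.cast_natCast] at h4
    rw [h4]
    push_cast
    linarith
  · rw [Int.toNat_of_nonpos h]
    push_cast
    linarith

theorem card_lattice_strip_le (T : Finset (ℤ × ℤ)) {u v : ℤ} (hu : u ≠ 0) {M R : ℝ}
    (hM : 1 ≤ M) (hR : 1 ≤ R) (hT : ∀ q ∈ T, |(q.2 : ℝ)| ≤ M ∧
      |((q.1 * u + q.2 * v : ℤ) : ℝ)| ≤ √2 * |(u : ℝ)| * R) :
    (T.card : ℝ) ≤ 12 * M * R := by
  have hs2 : √2 ≤ 3 / 2 := by
    rw [Real.sqrt_le_left (by norm_num)]; norm_num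
  have hu' : 0 < |(u : ℝ)| := abs_pos.2 (by exact_mod_cast hu)
  have hfib : ∀ d ∈ T.image Prod.snd, (T.filter fun q => q.2 = d).card ≤ ⌊4 * R⌋₊ := by
    intro d _
    rw [← Finset.card_image_of_injOn (f := Prod.fst)]
    · refine Nat.le_floor ((card_le_of_abs_sub_le _ (x := -(d * v / u : ℝ)) (r := √2 * R)
        (by positivity) ?_).trans (by nlinarith))
      intro c hc
      simp only [Finset.mem_image, Finset.mem_filter, Prod.exists] at hc
      obtain ⟨c, d', ⟨hq, rfl⟩, rfl⟩ := hc
      have h := (hT _ hq).2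
      push_cast at h
      have h1 : (c : ℝ) * u + d' * v = (c - -(d' * v / u : ℝ)) * u := by
        have : (u : ℝ) ≠ 0 := by exact_mod_cast hu
        field_simp
        ring
      rw [h1, abs_mul] at h
      refine le_of_mul_le_mul_right ?_ hu'
      linarith
    · rintro ⟨c, d'⟩ h ⟨c', d''⟩ h' hcc
      simp only [Finset.coe_filter, Set.mem_ofPred_eq] at h h' hcc
      rw [hcc, h.2, h'.2]
  have himg : ((T.image Prod.snd).card : ℝ) ≤ 2 * M + 1 := by
    refine card_le_of_abs_sub_le _ (x := 0) (by linarith) fun d hd => ?_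
    obtain ⟨q, hq, rfl⟩ := Finset.mem_image.1 hd
    simpa using (hT q hq).1
  calc (T.card : ℝ) ≤ ((⌊4 * R⌋₊ * (T.image Prod.snd).card : ℕ) : ℝ) := by
        exact_mod_cast Finset.card_le_mul_card_image T _ hfib
    _ = (⌊4 * R⌋₊ : ℝ) * (T.image Prod.snd).card := by push_cast; rfl
    _ ≤ (4 * R) * (2 * M + 1) := by
        gcongr
        exact Nat.floor_le (by linarith)
    _ ≤ 12 * M * R := by nlinarith

theorem card_gaussianInt_strip_le (T : Finset GaussianInt) {W : GaussianInt} (hW : W ≠ 0)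
    {Y δ : ℝ} (hY : 1 ≤ Y) (hδ : δ ≤ 1 / 2) (hT : ∀ π ∈ T, (π.norm : ℝ) ≤ Y ∧
      |((π * W).re : ℝ)| ≤ √(W.norm : ℝ) * Y ^ (1 / 2 - δ)) :
    (T.card : ℝ) ≤ 12 * Y ^ (1 - δ) := by
  have hM : 1 ≤ √Y := Real.one_le_sqrt.2 hY
  have hR : 1 ≤ Y ^ (1 / 2 - δ) := Real.one_le_rpow hY (by linarith)
  have hMR : 12 * √Y * Y ^ (1 / 2 - δ) = 12 * Y ^ (1 - δ) := by
    rw [Real.sqrt_eq_rpow, mul_assoc, ← Real.rpow_add (by linarith)]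
    ring_nf
  have hnorm (z : GaussianInt) : (z.norm : ℝ) = (z.re : ℝ) ^ 2 + (z.im : ℝ) ^ 2 := by
    rw [gaussianInt_norm_eq]; push_cast; rfl
  have hsqrt {a b : ℝ} (hab : |b| ≤ |a|) : √(a ^ 2 + b ^ 2) ≤ √2 * |a| := by
    rw [← Real.sqrt_sq_eq_abs, ← Real.sqrt_mul (by norm_num)]
    exact Real.sqrt_le_sqrt (by linarith [sq_le_sq.2 hab])
  rw [← hMR]
  rcases le_total |(W.im : ℝ)| |(W.re : ℝ)| with h | h
  · have hu : W.re ≠ 0 := by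
      intro h0
      rw [h0] at h
      exact hW (Zsqrtd.ext h0 (by rwa [Int.cast_zero, abs_zero, abs_nonpos_iff, Int.cast_eq_zero] at h))
    rw [← Finset.card_image_of_injective T (f := fun z : GaussianInt => (z.re, z.im))
      fun z z' hz => Zsqrtd.ext (Prod.ext_iff.1 hz).1 (Prod.ext_iff.1 hz).2]
    refine card_lattice_strip_le _ hu (v := -W.im) hM hR fun q hq => ?_
    obtain ⟨z, hz, rfl⟩ := Finset.mem_image.1 hq
    obtain ⟨h1, h2⟩ := hT z hz
    rw [hnorm] at h1 h2
    refine ⟨Real.abs_le_sqrt (by nlinarith), ?_⟩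
    have h3 : z.re * W.re + z.im * -W.im = (z * W).re := by rw [Zsqrtd.re_mul]; ring
    rw [h3]
    refine h2.trans ?_
    gcongr
    exact hsqrt h
  · have hu : W.im ≠ 0 := by
      intro h0
      rw [h0] at h
      exact hW (Zsqrtd.ext (by rwa [Int.cast_zero, abs_zero, abs_nonpos_iff, Int.cast_eq_zero] at h) h0)
    rw [← Finset.card_image_of_injective T (f := fun z : GaussianInt => (z.im, z.re))
      fun z z' hz => Zsqrtd.ext (Prod.ext_iff.1 hz).2 (Prod.ext_iff.1 hz).1]
    refine card_lattice_strip_le _ (neg_ne_zero.2 hu) (v := W.re) hM hR fun q hq => ?_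
    obtain ⟨z, hz, rfl⟩ := Finset.mem_image.1 hq
    obtain ⟨h1, h2⟩ := hT z hz
    rw [hnorm] at h1 h2
    refine ⟨Real.abs_le_sqrt (by nlinarith), ?_⟩
    have h3 : z.im * -W.im + z.re * W.re = (z * W).re := by rw [Zsqrtd.re_mul]; ring
    rw [h3]
    refine h2.trans ?_
    push_cast
    rw [abs_neg, add_comm]
    gcongr
    exact hsqrt h

/-- `n` has a divisor `N(π) m`, with `N(π) > y`, such that `π W` is abnormally close to the imaginary
axis for some nonzero sum `W` of `K` Gaussian integers of norm `m`. -/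
def HasNearlyImaginaryProduct (K : ℕ) (y δ : ℝ) (n : ℕ) : Prop :=
  ∃ (a m : ℕ) (π : GaussianInt) (w : Fin K → GaussianInt), n = a * m * π.norm.natAbs ∧
    y < π.norm ∧ (∀ j, (w j).norm = m) ∧ ∑ j, w j ≠ 0 ∧
    |((π * ∑ j, w j).re : ℝ)| < √((∑ j, w j).norm : ℝ) * (π.norm : ℝ) ^ (1 / 2 - δ)

set_option maxHeartbeats 1000000 in
open scoped Classical in
theorem card_hasNearlyImaginaryProduct_le (X K : ℕ) {y δ : ℝ} (hy : 1 ≤ y) (hδ0 : 0 ≤ δ)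
    (hδ : δ ≤ 1 / 2) :
    (((Finset.Icc 1 X).filter fun n => HasNearlyImaginaryProduct K y δ n).card : ℝ) ≤
      12 * 4 ^ K * X * (1 + Real.log X) ^ (2 ^ K + 1) * y ^ (-δ) := by
  set S := (Finset.Icc 1 X).filter fun n => HasNearlyImaginaryProduct K y δ n with hS
  have hex : ∀ n, HasNearlyImaginaryProduct K y δ n → _ := fun n hn => hn
  unfold HasNearlyImaginaryProduct at hex
  choose! a m π w hn hπ hw hW hre using hex
  set t : Finset (Σ _ : ℕ × ℕ, Fin K → GaussianInt) :=
    (Finset.Icc 1 X ×ˢ Finset.Icc 1 X).sigma fun q => Fintype.piFinset fun _ => latticeCircle q.2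
    with ht
  have hπn (z : GaussianInt) : ((z.norm.natAbs : ℕ) : ℝ) = (z.norm : ℝ) := by
    rw [← Int.cast_natCast, Int.natAbs_of_nonneg (GaussianInt.norm_nonneg z)]
  have hmaps : Set.MapsTo (fun n => (⟨(a n, m n), w n⟩ : Σ _ : ℕ × ℕ, Fin K → GaussianInt)) S t := by
    intro n hnS
    obtain ⟨hn1, hP⟩ := Finset.mem_filter.1 (Finset.mem_coe.1 hnS)
    rw [Finset.mem_Icc] at hn1
    have hd := hn n hP
    have hda : a n ∣ n := ⟨m n * (π n).norm.natAbs, by rw [← mul_assoc]; exact hd⟩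
    have hdm : m n ∣ n := ⟨a n * (π n).norm.natAbs, by rw [mul_left_comm, ← mul_assoc]; exact hd⟩
    have := Nat.le_of_dvd hn1.1 hda
    have := Nat.le_of_dvd hn1.1 hdm
    have := Nat.pos_of_dvd_of_pos hda hn1.1
    have := Nat.pos_of_dvd_of_pos hdm hn1.1
    simp only [ht, Finset.coe_sigma, Set.mem_sigma_iff, Finset.mem_coe, Finset.mem_product,
      Finset.mem_Icc, Fintype.mem_piFinset, mem_latticeCircle]
    exact ⟨⟨⟨by omega, by omega⟩, by omega, by omega⟩, hw n hP⟩
  have hfib : ∀ q ∈ t, ((S.filter fun n =>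
      (⟨(a n, m n), w n⟩ : Σ _ : ℕ × ℕ, Fin K → GaussianInt) = q).card : ℝ) ≤
      12 * (X / (q.1.1 * q.1.2)) * y ^ (-δ) := by
    rintro ⟨⟨b, c⟩, v⟩ hq
    simp only [ht, Finset.mem_sigma, Finset.mem_product, Finset.mem_Icc] at hq
    obtain ⟨⟨⟨hb, -⟩, hc, -⟩, -⟩ := hq
    dsimp only
    set F := S.filter fun n =>
      (⟨(a n, m n), w n⟩ : Σ _ : ℕ × ℕ, Fin K → GaussianInt) = ⟨(b, c), v⟩ with hF
    have hbc : (0 : ℝ) < b * c := by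
      have : 0 < b * c := by positivity
      exact_mod_cast this
    have hmem : ∀ n ∈ F, n ≤ X ∧ HasNearlyImaginaryProduct K y δ n ∧ a n = b ∧ m n = c ∧ w n = v := by
      intro n hnF
      simp only [hF, hS, Finset.mem_filter, Finset.mem_Icc, Sigma.mk.injEq, Prod.mk.injEq,
        heq_eq_eq] at hnF
      tauto
    have hle : ∀ n ∈ F, ((π n).norm : ℝ) ≤ X / (b * c) := by
      intro n hnF
      obtain ⟨hnX, hP, rfl, rfl, rfl⟩ := hmem n hnF
      rw [le_div_iff₀ hbc, ← hπn, mul_comm]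
      have := hn n hP
      rw [this] at hnX
      exact_mod_cast hnX
    rcases F.eq_empty_or_nonempty with h0 | ⟨n₀, hn₀⟩
    · rw [h0]
      simp only [Finset.card_empty, Nat.cast_zero]
      positivity
    have hyY : y ≤ X / (b * c) := (hπ n₀ (hmem n₀ hn₀).2.1).le.trans (hle n₀ hn₀)
    have hY : (1 : ℝ) ≤ X / (b * c) := hy.trans hyY
    have hinj : Set.InjOn π F := by
      intro n hnF n' hnF' h
      obtain ⟨-, hP, h1, h2, -⟩ := hmem n hnF
      obtain ⟨-, hP', h1', h2', -⟩ := hmem n' hnF'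
      rw [hn n hP, hn n' hP', h, h1, h1', h2, h2']
    have hv : ∑ j, v j ≠ 0 := by
      have := hmem n₀ hn₀
      rw [← this.2.2.2.2]
      exact hW n₀ this.2.1
    calc (F.card : ℝ) = ((F.image π).card : ℝ) := by rw [Finset.card_image_of_injOn hinj]
      _ ≤ 12 * (X / (b * c) : ℝ) ^ (1 - δ) := by
        refine card_gaussianInt_strip_le _ hv hY hδ fun z hz => ?_
        obtain ⟨n, hnF, rfl⟩ := Finset.mem_image.1 hz
        refine ⟨hle n hnF, ?_⟩
        have hle' := hle n hnF
        obtain ⟨hnX, hP, h1, h2, h3⟩ := hmem n hnF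
        have h4 := hre n hP
        rw [h3] at h4
        refine h4.le.trans ?_
        have h5 : (0 : ℝ) ≤ (π n).norm := by exact_mod_cast GaussianInt.norm_nonneg _
        gcongr
      _ = 12 * (X / (b * c)) * (X / (b * c) : ℝ) ^ (-δ) := by
        rw [sub_eq_add_neg, Real.rpow_add (by linarith), Real.rpow_one]
        ring
      _ ≤ 12 * (X / (b * c)) * y ^ (-δ) := by
        gcongr 12 * (X / (b * c)) * ?_
        exact Real.rpow_le_rpow_of_nonpos (by linarith) hyY (by linarith)
  have hcard : S.card = ∑ q ∈ t, (S.filter fun n =>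
      (⟨(a n, m n), w n⟩ : Σ _ : ℕ × ℕ, Fin K → GaussianInt) = q).card :=
    Finset.card_eq_sum_card_fiberwise hmaps
  calc (S.card : ℝ) ≤ ∑ q ∈ t, 12 * (X / (q.1.1 * q.1.2 : ℝ)) * y ^ (-δ) := by
        rw [hcard, Nat.cast_sum]
        exact Finset.sum_le_sum hfib
    _ = ∑ b ∈ Finset.Icc 1 X, ∑ c ∈ Finset.Icc 1 X,
          ((latticeCircle c).card : ℝ) ^ K * (12 * (X / (b * c : ℝ)) * y ^ (-δ)) := by
        rw [ht, Finset.sum_sigma, Finset.sum_product]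
        simp
    _ ≤ ∑ b ∈ Finset.Icc 1 X, ∑ c ∈ Finset.Icc 1 X,
          (4 * (c.divisors.card : ℝ)) ^ K * (12 * (X / (b * c : ℝ)) * y ^ (-δ)) := by
        gcongr with b _ c hc
        exact_mod_cast card_latticeCircle_le c (by rw [Finset.mem_Icc] at hc; omega)
    _ = 12 * 4 ^ K * X * ((∑ b ∈ Finset.Icc 1 X, (1 : ℝ) / b) *
          ∑ c ∈ Finset.Icc 1 X, (c.divisors.card : ℝ) ^ K / c) * y ^ (-δ) := by
        rw [Finset.sum_mul_sum, Finset.mul_sum, Finset.sum_mul]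
        refine Finset.sum_congr rfl fun b _ => ?_
        rw [Finset.mul_sum, Finset.sum_mul]
        refine Finset.sum_congr rfl fun c _ => ?_
        rw [mul_pow]
        ring
    _ ≤ 12 * 4 ^ K * X * ((1 + Real.log X) * (1 + Real.log X) ^ 2 ^ K) * y ^ (-δ) := by
        have hL : 0 ≤ Real.log X := Real.log_natCast_nonneg X
        gcongr
        · exact sum_Icc_inv_le X
        · exact sum_card_divisors_pow_div_le X K
    _ = 12 * 4 ^ K * X * (1 + Real.log X) ^ (2 ^ K + 1) * y ^ (-δ) := by ring

/-! ### Divisor recursion -/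

theorem zsqrtd_re_sum {d : ℤ} {ι : Type*} (s : Finset ι) (z : ι → Zsqrtd d) :
    (∑ j ∈ s, z j).re = ∑ j ∈ s, (z j).re :=
  map_sum (⟨⟨Zsqrtd.re, rfl⟩, fun _ _ => rfl⟩ : Zsqrtd d →+ ℤ) z s

theorem smooth_le_rpow {n : ℕ} (hn : n ≠ 0) {y : ℝ} (hy : 1 ≤ y)
    (hprime : ∀ p : ℕ, p.Prime → p ∣ n → (p : ℝ) ≤ y) (hsq : ∀ v : ℕ, v ^ 2 ∣ n → (v : ℝ) ≤ y)
    (hdiv : (n.divisors.card : ℝ) ≤ y) : (n : ℝ) ≤ y ^ (2 + Real.logb 2 y) := by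
  have hy0 : 0 < y := by linarith
  obtain ⟨u, b, hub, hu⟩ := Nat.sq_mul_squarefree n
  have hun : u ∣ n := ⟨b ^ 2, by rw [← hub, mul_comm]⟩
  have hω : (u.primeFactors.card : ℝ) ≤ Real.logb 2 y := by
    rw [Real.le_logb_iff_rpow_le one_lt_two hy0, Real.rpow_natCast]
    refine le_trans ?_ hdiv
    have h : 2 ^ n.primeFactors.card ≤ n.divisors.card := by
      rw [Nat.card_divisors hn]
      refine Finset.pow_card_le_prod _ _ _ fun p hp => ?_
      have := (Nat.mem_primeFactors.1 hp).1.factorization_pos_of_dvd hn (Nat.mem_primeFactors.1 hp).2.1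
      omega
    calc (2 : ℝ) ^ u.primeFactors.card ≤ 2 ^ n.primeFactors.card := by
          gcongr
          · norm_num
          · exact Nat.primeFactors_mono hun hn
      _ ≤ n.divisors.card := by exact_mod_cast h
  have hu' : (u : ℝ) ≤ y ^ u.primeFactors.card := by
    rw [← Finset.prod_const]
    nth_rw 1 [← Nat.prod_primeFactors_of_squarefree hu]
    rw [Nat.cast_prod]
    refine Finset.prod_le_prod (fun _ _ => by positivity) fun p hp => ?_
    exact hprime p (Nat.mem_primeFactors.1 hp).1 ((Nat.mem_primeFactors.1 hp).2.1.trans hun)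
  calc (n : ℝ) = (b : ℝ) ^ 2 * u := by rw [← hub]; push_cast; rfl
    _ ≤ y ^ 2 * y ^ u.primeFactors.card := by
        gcongr
        exact hsq b ⟨u, hub.symm⟩
    _ ≤ y ^ (2 : ℝ) * y ^ Real.logb 2 y := by
        rw [← Real.rpow_natCast, ← Real.rpow_natCast]
        gcongr
        norm_num
    _ = y ^ (2 + Real.logb 2 y) := (Real.rpow_add hy0 _ _).symm

theorem le_abs_re_sum {K : ℕ} (hK : 0 < K) {N : ℕ} (hN : N ≠ 0) {y δ : ℝ} (hy : 1 ≤ y)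
    (hδ : 0 ≤ δ) (hline : ¬ HasNearlyImaginaryProduct K y δ N)
    (hsq : ∀ v : ℕ, v ^ 2 ∣ N → (v : ℝ) ≤ y) (hdiv : (N.divisors.card : ℝ) ≤ y)
    {n : ℕ} (hnN : n ∣ N) (z : Fin K → GaussianInt) (hz : ∀ j, (z j).norm = n)
    (hre : (∑ j, z j).re ≠ 0) :
    (n : ℝ) ^ (1 / 2 - δ) / y ^ (2 + Real.logb 2 y) ≤ |((∑ j, z j).re : ℝ)| := by
  have hB : 0 < y ^ (2 + Real.logb 2 y) := Real.rpow_pos_of_pos (by linarith) _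
  induction n using Nat.strong_induction_on generalizing z with
  | _ n ih =>
    have hn : n ≠ 0 := ne_zero_of_dvd_ne_zero hN hnN
    by_cases hsmooth : ∀ p : ℕ, p.Prime → p ∣ n → (p : ℝ) ≤ y
    · have h1 : (n : ℝ) ≤ y ^ (2 + Real.logb 2 y) :=
        smooth_le_rpow hn hy hsmooth (fun v hv => hsq v (hv.trans hnN))
          (le_trans (by exact_mod_cast Finset.card_le_card (Nat.divisors_subset_of_dvd hN hnN)) hdiv)
      have hn1 : (1 : ℝ) ≤ n := by exact_mod_cast Nat.one_le_iff_ne_zero.2 hn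
      have h2 : (n : ℝ) ^ (1 / 2 - δ) ≤ n := by
        calc (n : ℝ) ^ (1 / 2 - δ) ≤ (n : ℝ) ^ (1 : ℝ) :=
              Real.rpow_le_rpow_of_exponent_le hn1 (by linarith)
          _ = n := Real.rpow_one _
      calc (n : ℝ) ^ (1 / 2 - δ) / y ^ (2 + Real.logb 2 y) ≤ 1 := by
            rw [div_le_one hB]
            exact h2.trans h1
        _ ≤ |((∑ j, z j).re : ℝ)| := by exact_mod_cast Int.one_le_abs hre
    · push Not at hsmooth
      obtain ⟨p, hp, ⟨m, rfl⟩, hpy⟩ := hsmooth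
      have hpm : ¬ p ∣ m := by
        rintro ⟨c, rfl⟩
        exact hpy.not_ge (hsq p (dvd_trans ⟨c, by ring⟩ hnN))
      obtain ⟨π, hπ, h⟩ := exists_re_eq_re_mul hp hpm (hz ⟨0, hK⟩)
      choose w hw hzw using fun j => h (z j) (hz j)
      have hsum : (∑ j, z j).re = (π * ∑ j, w j).re := by
        rw [zsqrtd_re_sum, Finset.mul_sum, zsqrtd_re_sum]
        exact Finset.sum_congr rfl fun j _ => hzw j
      rw [hsum] at hre ⊢
      have hW : ∑ j, w j ≠ 0 := by
        intro h0
        simp [h0] at hre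
      have hlt : m < p * m := by
        have : m ≠ 0 := by rintro rfl; simp at hn
        exact lt_mul_left (by omega) hp.one_lt
      have hmN : m ∣ N := (dvd_mul_left m p).trans hnN
      have hnear : √((∑ j, w j).norm : ℝ) * (p : ℝ) ^ (1 / 2 - δ) ≤ |((π * ∑ j, w j).re : ℝ)| := by
        by_contra hcon
        obtain ⟨a, ha⟩ := hnN
        refine hline ⟨a, m, π, w, ?_, ?_, hw, hW, ?_⟩
        · rw [ha, hπ, Int.natAbs_natCast]; ring
        · rw [hπ]; exact_mod_cast hpy
        · rw [hπ, Int.cast_natCast]; exact not_le.1 hcon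
      have habs : (m : ℝ) ^ (1 / 2 - δ) / y ^ (2 + Real.logb 2 y) ≤ √((∑ j, w j).norm : ℝ) := by
        rw [gaussianInt_norm_eq]
        push_cast
        by_cases hre0 : (∑ j, w j).re = 0
        · have him : (∑ j, (⟨0, -1⟩ : GaussianInt) * w j).re = (∑ j, w j).im := by
            rw [← Finset.mul_sum, Zsqrtd.re_mul]
            ring
          have := ih m hlt hmN (fun j => ⟨0, -1⟩ * w j)
            (fun j => by rw [Zsqrtd.norm_mul, hw, gaussianInt_norm_eq]; ring)
            (by
              rw [him]
              intro him0
              exact hW (Zsqrtd.ext hre0 him0))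
          rw [him] at this
          exact this.trans (Real.abs_le_sqrt (by nlinarith [sq_nonneg ((∑ j, w j).re : ℝ)]))
        · exact (ih m hlt hmN w hw hre0).trans
            (Real.abs_le_sqrt (by nlinarith [sq_nonneg ((∑ j, w j).im : ℝ)]))
      calc ((p * m : ℕ) : ℝ) ^ (1 / 2 - δ) / y ^ (2 + Real.logb 2 y)
          = (m : ℝ) ^ (1 / 2 - δ) / y ^ (2 + Real.logb 2 y) * (p : ℝ) ^ (1 / 2 - δ) := by
            rw [Nat.cast_mul, Real.mul_rpow (by positivity) (by positivity)]
            ring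
        _ ≤ √((∑ j, w j).norm : ℝ) * (p : ℝ) ^ (1 / 2 - δ) := by gcongr
        _ ≤ _ := hnear

/-- Every nonzero sum of `K` real parts of Gaussian integers of norm `n` is at least
`n ^ (1 / 2 - δ)`. -/
def SumsNotSmall (K : ℕ) (δ : ℝ) (n : ℕ) : Prop :=
  ∀ z : Fin K → GaussianInt, (∀ j, (z j).norm = n) → (∑ j, z j).re ≠ 0 →
    (n : ℝ) ^ (1 / 2 - δ) ≤ |((∑ j, z j).re : ℝ)|

theorem sumsNotSmall_of_not {K : ℕ} (hK : 0 < K) {n : ℕ} (hn : n ≠ 0) {y δ η : ℝ} (hy : 1 ≤ y)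
    (hη : 0 ≤ η) (hline : ¬ HasNearlyImaginaryProduct K y η n)
    (hsq : ∀ v : ℕ, v ^ 2 ∣ n → (v : ℝ) ≤ y) (hdiv : (n.divisors.card : ℝ) ≤ y)
    (hyn : y ^ (2 + Real.logb 2 y) ≤ (n : ℝ) ^ (δ - η)) : SumsNotSmall K δ n := by
  intro z hz hre
  have hn0 : (0 : ℝ) < n := by exact_mod_cast Nat.pos_of_ne_zero hn
  refine le_trans ?_ (le_abs_re_sum hK hn hy hη hline hsq hdiv dvd_rfl z hz hre)
  rw [le_div_iff₀ (Real.rpow_pos_of_pos (by linarith) _)]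
  calc (n : ℝ) ^ (1 / 2 - δ) * y ^ (2 + Real.logb 2 y)
      ≤ (n : ℝ) ^ (1 / 2 - δ) * (n : ℝ) ^ (δ - η) := by gcongr
    _ = (n : ℝ) ^ (1 / 2 - η) := by
        rw [← Real.rpow_add hn0]
        ring_nf

open scoped Classical in
theorem card_not_sumsNotSmall_le {K : ℕ} (hK : 0 < K) (X : ℕ) {y z δ η : ℝ} (hy : 1 ≤ y)
    (hη0 : 0 ≤ η) (hη : η ≤ 1 / 2) (hηδ : η ≤ δ) (hz : 0 ≤ z)
    (hyz : y ^ (2 + Real.logb 2 y) ≤ z ^ (δ - η)) :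
    (((Finset.Icc 1 X).filter fun n => ¬ SumsNotSmall K δ n).card : ℝ) ≤
      z + 12 * 4 ^ K * X * (1 + Real.log X) ^ (2 ^ K + 1) * y ^ (-η) + 2 * X / y +
        X * (1 + Real.log X) ^ 2 / y := by
  have hy0 : 0 < y := by linarith
  set E₁ := (Finset.Icc 1 X).filter fun n => HasNearlyImaginaryProduct K y η n
  set E₂ := (Finset.Icc 1 X).filter fun n => ∃ v : ℕ, y < v ∧ v ^ 2 ∣ n
  set E₃ := (Finset.Icc 1 X).filter fun n => y < n.divisors.card
  have hsub : ((Finset.Icc 1 X).filter fun n => ¬ SumsNotSmall K δ n) ⊆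
      Finset.Icc 1 ⌊z⌋₊ ∪ E₁ ∪ E₂ ∪ E₃ := by
    intro n hn
    obtain ⟨hnX, hn⟩ := Finset.mem_filter.1 hn
    have hn1 := (Finset.mem_Icc.1 hnX).1
    by_contra hcon
    simp only [E₁, E₂, E₃, Finset.mem_union, Finset.mem_filter, hnX, true_and, not_or,
      Finset.mem_Icc, hn1, Nat.le_floor_iff hz, not_exists, not_and] at hcon
    obtain ⟨⟨⟨h0, h1⟩, h2⟩, h3⟩ := hcon
    refine hn (sumsNotSmall_of_not hK (by omega) hy hη0 h1
      (fun v hv => not_lt.1 fun hlt => h2 v hlt hv) (not_lt.1 h3) (hyz.trans ?_))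
    exact Real.rpow_le_rpow hz (not_le.1 h0).le (by linarith)
  have h0 : ((Finset.Icc 1 ⌊z⌋₊).card : ℝ) ≤ z := by
    simpa using Nat.floor_le hz
  have h1 : (E₁.card : ℝ) ≤ _ := card_hasNearlyImaginaryProduct_le X K hy hη0 hη
  have h2 : (E₂.card : ℝ) ≤ _ := card_large_square_divisor_le X hy0
  have h3 : (E₃.card : ℝ) ≤ _ := card_many_divisors_le X hy0
  have h4 : (((Finset.Icc 1 X).filter fun n => ¬ SumsNotSmall K δ n).card : ℝ) ≤
      (Finset.Icc 1 ⌊z⌋₊).card + E₁.card + E₂.card + E₃.card := by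
    refine (Nat.cast_le.2 (Finset.card_le_card hsub)).trans ?_
    exact_mod_cast (Finset.card_union_le _ _).trans (Nat.add_le_add_right
      ((Finset.card_union_le _ _).trans
        (Nat.add_le_add_right (Finset.card_union_le _ _) _)) _)
  linarith

/-! ### Asymptotics -/

theorem tendsto_one_add_log : Tendsto (fun X : ℕ => 1 + Real.log X) atTop atTop :=
  tendsto_atTop_add_const_left _ _ (Real.tendsto_log_atTop.comp tendsto_natCast_atTop_atTop)

theorem eventually_rpow_logb_le (A : ℕ) {c : ℝ} (hc : 0 < c) :
    ∀ᶠ X : ℕ in atTop, ((1 + Real.log X) ^ A) ^ (2 + Real.logb 2 ((1 + Real.log X) ^ A)) ≤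
      (X / (1 + Real.log X) ^ 5 : ℝ) ^ c := by
  set M : ℝ := 6 * c + 2 * A + A ^ 2 / Real.log 2 with hM
  have hl2 : 0 < Real.log 2 := Real.log_pos one_lt_two
  have hM0 : 0 < M := by positivity
  have hlittle := (Real.isLittleO_pow_log_id_atTop (n := 2)).bound (div_pos hc hM0)
  have hlog : ∀ᶠ L : ℝ in atTop, 1 ≤ Real.log L := Real.tendsto_log_atTop.eventually_ge_atTop 1
  have hev := tendsto_one_add_log.eventually
    (hlittle.and (hlog.and (eventually_gt_atTop 0)))
  filter_upwards [hev, eventually_gt_atTop 0] with X hX hX0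
  obtain ⟨h1, h2, hL⟩ := hX
  have hX0' : (0 : ℝ) < X := by exact_mod_cast hX0
  set L := 1 + Real.log X with hLdef
  set s := Real.log L
  rw [id, Real.norm_of_nonneg (by positivity), Real.norm_of_nonneg hL.le, div_mul_eq_mul_div,
    le_div_iff₀ hM0] at h1
  rw [← Real.log_le_log_iff (by positivity) (by positivity), Real.log_rpow (by positivity),
    Real.log_rpow (by positivity), Real.log_div (by positivity) (by positivity), Real.logb,
    Real.log_pow, Real.log_pow]
  have h3 : Real.log X = L - 1 := by rw [hLdef]; ring
  rw [h3]
  have h4 : s ≤ s ^ 2 := by nlinarith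
  have h5 : (1 : ℝ) ≤ s ^ 2 := by nlinarith
  calc (2 + A * s / Real.log 2) * (A * s) = 2 * A * s + A ^ 2 / Real.log 2 * s ^ 2 := by ring
    _ ≤ 2 * A * s ^ 2 + A ^ 2 / Real.log 2 * s ^ 2 := by gcongr
    _ = s ^ 2 * M - 6 * c * s ^ 2 := by rw [hM]; ring
    _ ≤ c * L - 6 * c * s ^ 2 := by linarith
    _ ≤ c * (L - 1 - (5 : ℕ) * s) := by push_cast; nlinarith

open scoped Classical in
theorem eventually_card_not_sumsNotSmall_le {K : ℕ} (hK : 0 < K) {δ : ℝ} (hδ : 0 < δ) :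
    ∀ᶠ X : ℕ in atTop, (((Finset.Icc 1 X).filter fun n => ¬ SumsNotSmall K δ n).card : ℝ) ≤
      (4 + 12 * 4 ^ K) * X / (1 + Real.log X) ^ 5 := by
  set η := min (δ / 2) (1 / 2) with hη
  have hη0 : 0 < η := by positivity
  have hη1 : η ≤ 1 / 2 := min_le_right _ _
  have hη2 : η ≤ δ / 2 := min_le_left _ _
  obtain ⟨A, hA⟩ := exists_nat_ge (max 7 ((2 ^ K + 6) / η))
  have hA7 : 7 ≤ A := by exact_mod_cast (le_max_left _ _).trans hA
  have hAη : 2 ^ K + 6 ≤ A * η := (div_le_iff₀ hη0).1 ((le_max_right _ _).trans hA)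
  filter_upwards [eventually_rpow_logb_le A (c := δ - η) (by linarith),
    tendsto_one_add_log.eventually_ge_atTop 1] with X hX hL
  set L := 1 + Real.log X
  have hL0 : 0 < L := by linarith
  refine (card_not_sumsNotSmall_le hK X (one_le_pow₀ hL) hη0.le hη1 (by linarith)
    (by positivity) hX).trans ?_
  have hy7 : L ^ 7 ≤ L ^ A := pow_le_pow_right₀ hL hA7
  have h1 : 12 * 4 ^ K * X * L ^ (2 ^ K + 1) * (L ^ A) ^ (-η) ≤ 12 * 4 ^ K * X / L ^ 5 := by
    rw [le_div_iff₀ (by positivity)]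
    have : L ^ (2 ^ K + 1) * (L ^ A) ^ (-η) * L ^ 5 ≤ 1 := by
      rw [← Real.rpow_natCast, ← Real.rpow_natCast L A, ← Real.rpow_natCast L 5,
        ← Real.rpow_mul hL0.le, ← Real.rpow_add hL0, ← Real.rpow_add hL0]
      refine Real.rpow_le_one_of_one_le_of_nonpos hL ?_
      push_cast
      linarith
    calc 12 * 4 ^ K * (X : ℝ) * L ^ (2 ^ K + 1) * (L ^ A) ^ (-η) * L ^ 5
        = 12 * 4 ^ K * (X : ℝ) * (L ^ (2 ^ K + 1) * (L ^ A) ^ (-η) * L ^ 5) := by ring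
      _ ≤ 12 * 4 ^ K * (X : ℝ) * 1 := by gcongr
      _ = 12 * 4 ^ K * (X : ℝ) := mul_one _
  have h2 : 2 * X / L ^ A ≤ 2 * X / L ^ 5 := by
    gcongr
    omega
  have h3 : X * L ^ 2 / L ^ A ≤ X / L ^ 5 := by
    rw [div_le_div_iff₀ (by positivity) (by positivity), mul_assoc, ← pow_add]
    gcongr
  have h4 : (4 + 12 * 4 ^ K) * X / L ^ 5 =
      X / L ^ 5 + 12 * 4 ^ K * X / L ^ 5 + 2 * X / L ^ 5 + X / L ^ 5 := by ring
  linarith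

open scoped Classical in
/-- A subset of `S` is of density one if its complement has at most `C X / (log X) ^ 5` elements
up to `X`. -/
theorem densityOne_of_eventually_le {S' : Set ℕ} (hS : S' ⊆ sumTwoSq) {C : ℝ}
    (h : ∀ᶠ X : ℕ in atTop,
      (((Finset.Icc 1 X).filter fun n => n ∈ sumTwoSq \ S').card : ℝ) ≤
        C * X / (1 + Real.log X) ^ 5) : DensityOne S' := by
  refine ⟨hS, ?_⟩
  have hcard : ∀ (T : Set ℕ), T ⊆ sumTwoSq → ∀ X : ℕ,
      Nat.card {n : ℕ | n ∈ T ∧ n ≤ X} = ((Finset.Icc 1 X).filter fun n => n ∈ T).card := by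
    intro T hT X
    rw [← Set.ncard_coe_finset, Nat.card_coe_set_eq]
    congr 1
    ext n
    have : n ∈ T → 1 ≤ n := fun hn => (hT hn).1
    simp
    tauto
  have hsum (X : ℕ) : (((Finset.Icc 1 X).filter fun n => n ∈ sumTwoSq).card : ℝ) ≤
      ((Finset.Icc 1 X).filter fun n => n ∈ S').card +
        ((Finset.Icc 1 X).filter fun n => n ∈ sumTwoSq \ S').card := by
    norm_cast
    refine (Finset.card_le_card fun n hn => ?_).trans (Finset.card_union_le _ _)
    simp only [Finset.mem_union, Finset.mem_filter, Set.mem_sdiff] at hn ⊢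
    tauto
  have hlim : Tendsto (fun X : ℕ => 1 - 1024 * C / (1 + Real.log X)) atTop (𝓝 1) := by
    simpa using (tendsto_one_add_log.const_div_atTop (1024 * C)).const_sub 1
  refine tendsto_of_tendsto_of_tendsto_of_le_of_le' hlim tendsto_const_nhds ?_ ?_
  · filter_upwards [h, eventually_gt_atTop 0] with X hX hX0
    have hlow := le_card_sumTwoSq X hX0
    have hX0' : (0 : ℝ) < X := by exact_mod_cast hX0
    have hL : 0 < 1 + Real.log X := by linarith [Real.log_natCast_nonneg X]
    rw [hcard _ subset_rfl] at hlow ⊢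
    rw [hcard _ hS]
    have hsX := hsum X
    set L := 1 + Real.log X
    set a : ℝ := (((Finset.Icc 1 X).filter fun n => n ∈ S').card : ℝ)
    set b : ℝ := (((Finset.Icc 1 X).filter fun n => n ∈ sumTwoSq).card : ℝ)
    set e : ℝ := (((Finset.Icc 1 X).filter fun n => n ∈ sumTwoSq \ S').card : ℝ)
    have he : 0 ≤ e := by positivity
    have hC : 0 ≤ C := by
      have := (le_div_iff₀ (by positivity)).1 (he.trans hX)
      nlinarith
    have hb : 0 < b := by
      by_contra hb
      have : 1024 * L ^ 4 * b ≤ 0 := mul_nonpos_of_nonneg_of_nonpos (by positivity) (not_lt.1 hb)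
      linarith
    have hle : e ≤ 1024 * C / L * b := by
      calc e ≤ C * X / L ^ 5 := hX
        _ ≤ C * (1024 * L ^ 4 * b) / L ^ 5 := by gcongr
        _ = 1024 * C / L * b := by field_simp
    rw [le_div_iff₀ hb]
    linarith
  · refine Eventually.of_forall fun X => ?_
    rw [hcard _ subset_rfl, hcard _ hS]
    refine div_le_one_of_le₀ ?_ (by positivity)
    norm_cast
    exact Finset.card_le_card (Finset.monotone_filter_right _ fun n _ hn => hS hn)

/-- Semi-quasi-correlations, Kurlberg–Sartori: for a density one
subsequence of `λ ∈ S`, all sufficiently large `λ ∈ S'`, and each coordinate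
`i ∈ {1,2}`: every nonzero sum `ξ^i₁ + ⋯ + ξ^i_{2ℓ}` of `i`-th coordinates of lattice
points with `|ξ_j|² = λ` satisfies `|ξ^i₁ + ⋯ + ξ^i_{2ℓ}| ≥ λ^{1/2-δ}`. -/
theorem semi_quasi_correlations (ℓ : ℕ) (hℓ : 2 ≤ ℓ) (δ : ℝ) (hδ : 0 < δ) :
    ∃ S' : Set ℕ, DensityOne S' ∧ ∃ Λ₀ : ℕ,
      ∀ lam ∈ S', Λ₀ ≤ lam →
        ∀ ξ : Fin (2 * ℓ) → ℤ × ℤ,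
          (∀ j, (ξ j).1 ^ 2 + (ξ j).2 ^ 2 = (lam : ℤ)) →
          ((∑ j, (ξ j).1) ≠ 0 →
            (lam : ℝ) ^ ((1/2 : ℝ) - δ) ≤ ((|∑ j, (ξ j).1| : ℤ) : ℝ)) ∧
          ((∑ j, (ξ j).2) ≠ 0 →
            (lam : ℝ) ^ ((1/2 : ℝ) - δ) ≤ ((|∑ j, (ξ j).2| : ℤ) : ℝ)) := by
  refine ⟨{n | n ∈ sumTwoSq ∧ SumsNotSmall (2 * ℓ) δ n}, ?_, 0, ?_⟩
  · classical
    refine densityOne_of_eventually_le (fun n hn => hn.1) (C := 4 + 12 * 4 ^ (2 * ℓ)) ?_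
    filter_upwards [eventually_card_not_sumsNotSmall_le (K := 2 * ℓ) (by omega) hδ] with X hX
    refine le_trans (Nat.cast_le.2 (Finset.card_le_card ?_)) hX
    intro n hn
    simp only [Finset.mem_filter, Set.mem_sdiff, Set.mem_ofPred_eq] at hn ⊢
    tauto
  · rintro lam ⟨-, hlam⟩ - ξ hξ
    constructor
    · intro h
      have hsum : (∑ j, (⟨(ξ j).1, (ξ j).2⟩ : GaussianInt)).re = ∑ j, (ξ j).1 := zsqrtd_re_sum _ _
      have := hlam (fun j => ⟨(ξ j).1, (ξ j).2⟩)
        (fun j => by rw [gaussianInt_norm_eq]; exact hξ j) (by rwa [hsum])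
      rw [hsum] at this
      rwa [Int.cast_abs]
    · intro h
      have hsum : (∑ j, (⟨(ξ j).2, (ξ j).1⟩ : GaussianInt)).re = ∑ j, (ξ j).2 := zsqrtd_re_sum _ _
      have := hlam (fun j => ⟨(ξ j).2, (ξ j).1⟩)
        (fun j => by rw [gaussianInt_norm_eq, add_comm]; exact hξ j) (by rwa [hsum])
      rw [hsum] at this
      rwa [Int.cast_abs]
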